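/- Let L be a hitomezashi loop. If L has a north-extremal or south-extremal horizontal stitch with longitude a, then L has exactly two stitches with longitude a. If L has an east-extremal or west-extremal vertical stitch with latitude b, then L has exactly two stitches with latitude b. -/

import Mathlib

/-- A stitch is a unit segment of the grid: `vert i j` is the vertical segment from
`(i,j)` to `(i,j+1)`; `horiz i j` is the horizontal segment from `(i,j)` to `(i+1,j)`. -/
inductive Stitch : Type
  | vert : ℤ → ℤ → Stitch
  | horiz : ℤ → ℤ → Stitch
  deriving DecidableEq

/-- Membership of a stitch in the hitomezashi pattern with labels `ε` (vertical lines)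
and `η` (horizontal lines). -/
def Stitch.InPattern (ε η : ℤ → ZMod 2) : Stitch → Prop
  | .vert i j => (j : ZMod 2) = ε i
  | .horiz i j => (i : ZMod 2) = η j

/-- The stitch as a subset of the plane. -/
def Stitch.seg : Stitch → Set (ℝ × ℝ)
  | .vert i j => segment ℝ ((i : ℝ), (j : ℝ)) ((i : ℝ), (j : ℝ) + 1)
  | .horiz i j => segment ℝ ((i : ℝ), (j : ℝ)) ((i : ℝ) + 1, (j : ℝ))

/-- The union of the segments of a set of stitches. -/
def curveOf (S : Set Stitch) : Set (ℝ × ℝ) := ⋃ s ∈ S, s.seg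

/-- `C` is a simple closed curve: it is homeomorphic to a circle. -/
def IsCircle (C : Set (ℝ × ℝ)) : Prop :=
  Nonempty (C ≃ₜ Metric.sphere (0 : ℝ × ℝ) 1)

/-- The interior of a closed curve `C`: the union of the bounded connected
components of its complement. -/
def intOf (C : Set (ℝ × ℝ)) : Set (ℝ × ℝ) :=
  {p | p ∉ C ∧ Bornology.IsBounded (connectedComponentIn Cᶜ p)}

/-- The exterior of a closed curve `C`: the union of the unbounded connected
components of its complement. -/
def extOf (C : Set (ℝ × ℝ)) : Set (ℝ × ℝ) :=
  {p | p ∉ C ∧ ¬ Bornology.IsBounded (connectedComponentIn Cᶜ p)}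

/-- The open unit cell with southwest corner `(i,j)`. -/
def cell (i j : ℤ) : Set (ℝ × ℝ) :=
  Set.Ioo (i : ℝ) ((i : ℝ) + 1) ×ˢ Set.Ioo (j : ℝ) ((j : ℝ) + 1)

/-- A hitomezashi loop in the pattern with labels `ε`, `η`: a (finite) set of stitches
of the pattern whose union is a simple closed curve. -/
structure HLoop (ε η : ℤ → ZMod 2) where
  stitches : Finset Stitch
  inPattern : ∀ s ∈ stitches, s.InPattern ε η
  isCircle : IsCircle (curveOf ↑stitches)

theorem isPreconnected_sphere_diff_singleton (p : ℝ × ℝ) (hp : p ∈ Metric.sphere (0 : ℝ × ℝ) 1) :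
    IsPreconnected (Metric.sphere (0 : ℝ × ℝ) 1 \ {p}) := by
  have hp1 : ‖p‖ = 1 := by simpa using hp
  have hp0 : p ≠ 0 := by
    rintro rfl
    simp at hp1
  set K : Set (ℝ × ℝ) := {v | ∀ t : ℝ, 0 ≤ t → v ≠ t • p} with hK
  have hstar : StarConvex ℝ (-p) K := by
    intro v hv s t hs ht hst r hr h
    rcases ht.eq_or_lt with rfl | ht
    · obtain rfl : s = 1 := by linarith
      have : (1 + r) • p = 0 := by
        rw [add_smul, ← h]
        simp
      rcases smul_eq_zero.1 this with h' | h'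
      · linarith
      · exact hp0 h'
    · refine hv (t⁻¹ * (s + r)) (by positivity) ?_
      rw [mul_smul, add_smul, ← h, smul_neg, add_neg_cancel_left, inv_smul_smul₀ ht.ne']
  have hne : (-p) ∈ K := by
    intro t ht h
    have : (1 + t) • p = 0 := by
      rw [add_smul, ← h]
      simp
    rcases smul_eq_zero.1 this with h' | h'
    · linarith
    · exact hp0 h'
  have hKc : IsPreconnected K := (hstar.isPathConnected hne).isConnected.isPreconnected
  have hK0 : ∀ v ∈ K, v ≠ 0 := fun v hv h => hv 0 le_rfl (by simp [h])
  have himage : (fun v : ℝ × ℝ => ‖v‖⁻¹ • v) '' K = Metric.sphere (0 : ℝ × ℝ) 1 \ {p} := by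
    ext w
    constructor
    · rintro ⟨v, hv, rfl⟩
      have hv0 : ‖v‖ ≠ 0 := norm_ne_zero_iff.2 (hK0 v hv)
      refine ⟨by simp [norm_smul, hv0], fun h => hv ‖v‖ (norm_nonneg v) ?_⟩
      rw [← Set.mem_singleton_iff.1 h, smul_inv_smul₀ hv0]
    · rintro ⟨hw, hwp⟩
      have hw1 : ‖w‖ = 1 := by simpa using hw
      refine ⟨w, fun t ht h => hwp ?_, by simp [hw1]⟩
      have : t = 1 := by
        rw [h, norm_smul, hp1, mul_one, Real.norm_of_nonneg ht] at hw1
        exact hw1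
      simp [h, this]
  rw [← himage]
  refine hKc.image _ (ContinuousOn.smul (ContinuousOn.inv₀ continuous_norm.continuousOn ?_)
    continuousOn_id)
  exact fun v hv => norm_ne_zero_iff.2 (hK0 v hv)

theorem IsCircle.isPreconnected_diff_singleton {C : Set (ℝ × ℝ)} (hC : IsCircle C) {q : ℝ × ℝ}
    (hq : q ∈ C) : IsPreconnected (C \ {q}) := by
  obtain ⟨e⟩ := hC
  have h := isPreconnected_sphere_diff_singleton (e ⟨q, hq⟩) (e ⟨q, hq⟩).2
  have h2 : IsPreconnected ({e ⟨q, hq⟩}ᶜ : Set (Metric.sphere (0 : ℝ × ℝ) 1)) := by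
    rw [← Topology.IsInducing.subtypeVal.isPreconnected_image]
    convert h using 1
    ext z
    constructor
    · rintro ⟨w, hw, rfl⟩
      exact ⟨w.2, fun h => hw (Subtype.ext h)⟩
    · rintro ⟨hz, hzq⟩
      exact ⟨⟨z, hz⟩, fun h => hzq (congrArg Subtype.val h), rfl⟩
  have h3 := (h2.image _ e.symm.continuous.continuousOn).image _ continuous_subtype_val.continuousOn
  convert h3 using 1
  ext z
  constructor
  · rintro ⟨hz, hzq⟩
    refine ⟨⟨z, hz⟩, ⟨e ⟨z, hz⟩, fun h => hzq ?_, by simp⟩, rfl⟩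
    exact congrArg Subtype.val (e.injective h)
  · rintro ⟨-, ⟨w, hw, rfl⟩, rfl⟩
    refine ⟨(e.symm w).2, fun h => hw ?_⟩
    have h' : e.symm w = ⟨q, hq⟩ := Subtype.ext h
    rw [← h']
    simp

theorem IsCircle.isPreconnected {C : Set (ℝ × ℝ)} (hC : IsCircle C) : IsPreconnected C := by
  obtain ⟨e⟩ := hC
  have h : IsPreconnected (Metric.sphere (0 : ℝ × ℝ) 1) :=
    isPreconnected_sphere (by simp [← Module.finrank_eq_rank]) 0 1
  have h2 := ((isPreconnected_iff_preconnectedSpace.1 h).isPreconnected_univ.image _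
    e.symm.continuous.continuousOn).image _ continuous_subtype_val.continuousOn
  rwa [Set.image_univ, e.symm.range_coe, Set.image_univ, Subtype.range_coe] at h2

/-- The incidence relation between stitches and their endpoints. -/
def Stitch.Incident : Stitch → ℤ × ℤ → Prop
  | .vert i j, v => v = (i, j) ∨ v = (i, j + 1)
  | .horiz i j, v => v = (i, j) ∨ v = (i + 1, j)

/-- A lattice point as a point of the plane. -/
def latticePoint (v : ℤ × ℤ) : ℝ × ℝ := ((v.1 : ℝ), (v.2 : ℝ))

theorem Stitch.mem_seg_vert {i j : ℤ} {z : ℝ × ℝ} :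
    z ∈ (Stitch.vert i j).seg ↔ z.1 = i ∧ (j : ℝ) ≤ z.2 ∧ z.2 ≤ j + 1 := by
  rw [Stitch.seg, ← Prod.image_mk_segment_right, segment_eq_Icc (by linarith)]
  constructor
  · rintro ⟨y, hy, rfl⟩
    exact ⟨rfl, hy⟩
  · rintro ⟨h, hy⟩
    exact ⟨z.2, hy, by rw [← h]⟩

theorem Stitch.mem_seg_horiz {i j : ℤ} {z : ℝ × ℝ} :
    z ∈ (Stitch.horiz i j).seg ↔ z.2 = j ∧ (i : ℝ) ≤ z.1 ∧ z.1 ≤ i + 1 := by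
  rw [Stitch.seg, ← Prod.image_mk_segment_left, segment_eq_Icc (by linarith)]
  constructor
  · rintro ⟨y, hy, rfl⟩
    exact ⟨rfl, hy⟩
  · rintro ⟨h, hy⟩
    exact ⟨z.1, hy, by rw [← h]⟩

theorem Stitch.isClosed_seg (s : Stitch) : IsClosed s.seg := by
  cases s with
  | vert i j =>
    have : (Stitch.vert i j).seg = {z | z.1 = (i : ℝ) ∧ (j : ℝ) ≤ z.2 ∧ z.2 ≤ (j : ℝ) + 1} :=
      Set.ext fun _ => Stitch.mem_seg_vert
    rw [this]
    exact (isClosed_eq continuous_fst continuous_const).inter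
      ((isClosed_le continuous_const continuous_snd).inter
        (isClosed_le continuous_snd continuous_const))
  | horiz i j =>
    have : (Stitch.horiz i j).seg = {z | z.2 = (j : ℝ) ∧ (i : ℝ) ≤ z.1 ∧ z.1 ≤ (i : ℝ) + 1} :=
      Set.ext fun _ => Stitch.mem_seg_horiz
    rw [this]
    exact (isClosed_eq continuous_snd continuous_const).inter
      ((isClosed_le continuous_const continuous_fst).inter
        (isClosed_le continuous_fst continuous_const))

theorem isClosed_curveOf {S : Set Stitch} (hS : S.Finite) : IsClosed (curveOf S) :=
  hS.isClosed_biUnion fun s _ => s.isClosed_seg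

theorem Stitch.Incident.latticePoint_mem_seg {s : Stitch} {v : ℤ × ℤ} (h : s.Incident v) :
    latticePoint v ∈ s.seg := by
  cases s <;> rcases h with rfl | rfl <;>
    simp [Stitch.mem_seg_vert, Stitch.mem_seg_horiz, latticePoint]

theorem Stitch.Incident.exists_ne {s : Stitch} {v : ℤ × ℤ} (h : s.Incident v) :
    ∃ u, s.Incident u ∧ u ≠ v := by
  cases s with
  | vert i j =>
    rcases h with rfl | rfl
    · exact ⟨_, Or.inr rfl, by simp⟩
    · exact ⟨_, Or.inl rfl, by simp⟩
  | horiz i j =>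
    rcases h with rfl | rfl
    · exact ⟨_, Or.inr rfl, by simp⟩
    · exact ⟨_, Or.inl rfl, by simp⟩

theorem one_le_dist_latticePoint {u v : ℤ × ℤ} (h : u ≠ v) :
    1 ≤ dist (latticePoint u) (latticePoint v) := by
  rw [Prod.dist_eq, le_max_iff]
  have hint : ∀ {m n : ℤ}, m ≠ n → 1 ≤ dist (m : ℝ) n := fun hmn => by
    rw [Int.dist_cast_real]
    exact Int.pairwise_one_le_dist hmn
  by_cases h1 : u.1 = v.1
  · exact Or.inr (hint fun h2 => h (Prod.ext h1 h2))
  · exact Or.inl (hint h1)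

/-- Every stitch has a midpoint. -/
theorem Stitch.Incident.exists_midpoint {s : Stitch} {v : ℤ × ℤ} (h : s.Incident v) :
    ∃ q ∈ s.seg, dist q (latticePoint v) = 1 / 2 ∧
      ∀ z ∈ s.seg, dist z (latticePoint v) = 1 / 2 → z = q := by
  cases s with
  | vert i j =>
    refine ⟨((i : ℝ), j + 1 / 2), by rw [Stitch.mem_seg_vert]; norm_num, ?_, ?_⟩
    · rcases h with rfl | rfl <;>
        norm_num [latticePoint, Prod.dist_eq, Real.dist_eq, abs_of_nonneg]
    · intro z hz hd
      obtain ⟨h1, h2, h3⟩ := Stitch.mem_seg_vert.1 hz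
      refine Prod.ext h1 ?_
      rcases h with rfl | rfl
      · rw [Prod.dist_eq, h1] at hd
        simp only [latticePoint, dist_self, Real.dist_eq] at hd
        rw [abs_of_nonneg (by linarith), max_eq_right (by linarith)] at hd
        simp only
        linarith
      · rw [Prod.dist_eq, h1] at hd
        simp only [latticePoint, dist_self, Real.dist_eq] at hd
        push_cast at hd
        rw [abs_of_nonpos (by linarith), max_eq_right (by linarith)] at hd
        simp only
        linarith
  | horiz i j =>
    refine ⟨((i : ℝ) + 1 / 2, (j : ℝ)), by rw [Stitch.mem_seg_horiz]; norm_num, ?_, ?_⟩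
    · rcases h with rfl | rfl <;>
        norm_num [latticePoint, Prod.dist_eq, Real.dist_eq, abs_of_nonneg]
    · intro z hz hd
      obtain ⟨h1, h2, h3⟩ := Stitch.mem_seg_horiz.1 hz
      refine Prod.ext ?_ h1
      rcases h with rfl | rfl
      · rw [Prod.dist_eq, h1] at hd
        simp only [latticePoint, dist_self, Real.dist_eq] at hd
        rw [abs_of_nonneg (by linarith), max_eq_left (by linarith)] at hd
        simp only
        linarith
      · rw [Prod.dist_eq, h1] at hd
        simp only [latticePoint, dist_self, Real.dist_eq] at hd
        push_cast at hd
        rw [abs_of_nonpos (by linarith), max_eq_left (by linarith)] at hd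
        simp only
        linarith

theorem ZMod.intCast_two_inj_of_abs_sub_le {i i' : ℤ} (h : (i : ZMod 2) = i') (h1 : i ≤ i' + 1)
    (h2 : i' ≤ i + 1) : i = i' := by
  rw [ZMod.intCast_eq_intCast_iff_dvd_sub] at h
  omega

theorem Stitch.InPattern.exists_incident {ε η : ℤ → ZMod 2} {s t : Stitch}
    (hs : s.InPattern ε η) (ht : t.InPattern ε η) (hst : s ≠ t) {z : ℝ × ℝ} (hzs : z ∈ s.seg)
    (hzt : z ∈ t.seg) : ∃ v, s.Incident v ∧ t.Incident v ∧ z = latticePoint v := by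
  have hvh : ∀ i j i' j' : ℤ, z ∈ (Stitch.vert i j).seg → z ∈ (Stitch.horiz i' j').seg →
      ∃ v, (Stitch.vert i j).Incident v ∧ (Stitch.horiz i' j').Incident v ∧
        z = latticePoint v := by
    intro i j i' j' h1 h2
    rw [Stitch.mem_seg_vert] at h1
    rw [Stitch.mem_seg_horiz] at h2
    obtain ⟨h1, h3, h4⟩ := h1
    obtain ⟨h2, h5, h6⟩ := h2
    rw [h2] at h3 h4
    rw [h1] at h5 h6
    norm_cast at h3 h4 h5 h6
    refine ⟨(i, j'), ?_, ?_, Prod.ext h1 h2⟩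
    · simp only [Stitch.Incident, Prod.mk.injEq, true_and]
      omega
    · simp only [Stitch.Incident, Prod.mk.injEq, and_true]
      omega
  cases s with
  | vert i j =>
    cases t with
    | vert i' j' =>
      obtain ⟨h1, h2, h3⟩ := Stitch.mem_seg_vert.1 hzs
      obtain ⟨h4, h5, h6⟩ := Stitch.mem_seg_vert.1 hzt
      obtain rfl : i = i' := by exact_mod_cast h1.symm.trans h4
      have h7 := h2.trans h6
      have h8 := h5.trans h3
      norm_cast at h7 h8
      exact absurd (congrArg _ (ZMod.intCast_two_inj_of_abs_sub_le
        (Eq.trans hs (Eq.symm ht)) h7 h8)) hst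
    | horiz i' j' => exact hvh _ _ _ _ hzs hzt
  | horiz i j =>
    cases t with
    | vert i' j' =>
      obtain ⟨v, h1, h2, h3⟩ := hvh _ _ _ _ hzt hzs
      exact ⟨v, h2, h1, h3⟩
    | horiz i' j' =>
      obtain ⟨h1, h2, h3⟩ := Stitch.mem_seg_horiz.1 hzs
      obtain ⟨h4, h5, h6⟩ := Stitch.mem_seg_horiz.1 hzt
      obtain rfl : j = j' := by exact_mod_cast h1.symm.trans h4
      have h7 := h2.trans h6
      have h8 := h5.trans h3
      norm_cast at h7 h8
      exact absurd (congrArg (Stitch.horiz · j) (ZMod.intCast_two_inj_of_abs_sub_le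
        (Eq.trans hs (Eq.symm ht)) h7 h8)) hst

/-- The combinatorial content of being a hitomezashi loop: no endpoint of a stitch is free, and
the stitches are connected through shared endpoints. -/
structure IsGridLoop (ε η : ℤ → ZMod 2) (S : Set Stitch) : Prop where
  finite : S.Finite
  inPattern : ∀ s ∈ S, s.InPattern ε η
  exists_ne : ∀ s ∈ S, ∀ v, s.Incident v → ∃ t ∈ S, t ≠ s ∧ t.Incident v
  connected : ∀ O : Set Stitch, (∃ s ∈ S, s ∈ O) →
    (∀ s ∈ S, ∀ t ∈ S, s ∈ O → ∀ v, s.Incident v → t.Incident v → t ∈ O) → S ⊆ O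

theorem HLoop.isGridLoop {ε η : ℤ → ZMod 2} (L : HLoop ε η) :
    IsGridLoop ε η (L.stitches : Set Stitch) where
  finite := L.stitches.finite_toSet
  inPattern := L.inPattern
  exists_ne s hs v hv := by
    by_contra! hcon
    obtain ⟨q, hqs, hqv, hq⟩ := hv.exists_midpoint
    obtain ⟨u, hus, huv⟩ := hv.exists_ne
    set D : Set (ℝ × ℝ) := {z | 1 / 2 ≤ dist z (latticePoint v)}
    have hD : IsClosed D :=
      isClosed_le continuous_const (continuous_id.dist continuous_const)
    have hA : IsClosed (s.seg ∩ Metric.closedBall (latticePoint v) (1 / 2)) :=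
      s.isClosed_seg.inter Metric.isClosed_closedBall
    have hB : IsClosed (curveOf ((L.stitches : Set Stitch) \ {s}) ∪ s.seg ∩ D) :=
      (isClosed_curveOf (L.stitches.finite_toSet.subset Set.sdiff_subset)).union
        (s.isClosed_seg.inter hD)
    have hseg : s.seg ⊆ curveOf ↑L.stitches := Set.subset_biUnion_of_mem (u := Stitch.seg) hs
    have hconn := L.isCircle.isPreconnected_diff_singleton (hseg hqs)
    have hfar : ∀ z ∈ s.seg, z ∈ curveOf ((L.stitches : Set Stitch) \ {s}) →
        1 ≤ dist z (latticePoint v) := by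
      intro z hz hz'
      obtain ⟨t, ⟨ht, hts⟩, hzt⟩ := Set.mem_iUnion₂.1 hz'
      obtain ⟨w, hws, hwt, rfl⟩ := (L.inPattern s hs).exists_incident (L.inPattern t ht)
        (Ne.symm hts) hz hzt
      refine one_le_dist_latticePoint ?_
      rintro rfl
      exact hcon t ht hts hwt
    obtain ⟨z, ⟨hzC, hzq⟩, ⟨hzs, hzv⟩, hzB⟩ := isPreconnected_closed_iff.1 hconn _ _ hA hB
      (by
        rintro z ⟨hz, -⟩
        obtain ⟨t, ht, hzt⟩ := Set.mem_iUnion₂.1 hz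
        by_cases hts : t = s
        · subst hts
          rcases le_total (dist z (latticePoint v)) (1 / 2) with h | h
          · exact Or.inl ⟨hzt, h⟩
          · exact Or.inr (Or.inr ⟨hzt, h⟩)
        · exact Or.inr (Or.inl (Set.mem_biUnion (show t ∈ (L.stitches : Set Stitch) \ {s} from ⟨ht, hts⟩) hzt)))
      ⟨latticePoint v, ⟨hseg hv.latticePoint_mem_seg, by
        rintro rfl
        norm_num at hqv⟩, hv.latticePoint_mem_seg, by simp⟩
      ⟨latticePoint u, ⟨hseg hus.latticePoint_mem_seg, by
        rintro rfl
        have := one_le_dist_latticePoint huv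
        norm_num [hqv] at this⟩, Or.inr ⟨hus.latticePoint_mem_seg, by
        have := one_le_dist_latticePoint huv
        change (1 / 2 : ℝ) ≤ dist _ _
        linarith⟩⟩
    rw [Metric.mem_closedBall] at hzv
    rcases hzB with h | ⟨-, h⟩
    · have := hfar z hzs h
      linarith
    · exact hzq (hq z hzs (le_antisymm hzv h))
  connected O := by
    rintro ⟨s, hs, hsO⟩ hO t ht
    by_contra htO
    have hA : IsClosed (curveOf ((L.stitches : Set Stitch) ∩ O)) :=
      isClosed_curveOf (L.stitches.finite_toSet.subset Set.inter_subset_left)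
    have hB : IsClosed (curveOf ((L.stitches : Set Stitch) \ O)) :=
      isClosed_curveOf (L.stitches.finite_toSet.subset Set.sdiff_subset)
    have hmem : ∀ {S : Set Stitch} {r : Stitch}, r ∈ S → r.seg ⊆ curveOf S :=
      fun hr => Set.subset_biUnion_of_mem (u := Stitch.seg) hr
    have hne : ∀ r : Stitch, r.seg.Nonempty := by
      rintro (⟨i, j⟩ | ⟨i, j⟩)
      · exact ⟨_, left_mem_segment ℝ _ _⟩
      · exact ⟨_, left_mem_segment ℝ _ _⟩
    obtain ⟨z, -, hzA, hzB⟩ := isPreconnected_closed_iff.1 L.isCircle.isPreconnected _ _ hA hB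
      (by
        intro z hz
        obtain ⟨r, hr, hzr⟩ := Set.mem_iUnion₂.1 hz
        by_cases hrO : r ∈ O
        · exact Or.inl (hmem (S := (L.stitches : Set Stitch) ∩ O) ⟨hr, hrO⟩ hzr)
        · exact Or.inr (hmem (S := (L.stitches : Set Stitch) \ O) ⟨hr, hrO⟩ hzr))
      (by
        obtain ⟨z, hz⟩ := hne s
        exact ⟨z, hmem hs hz, hmem (S := (L.stitches : Set Stitch) ∩ O) ⟨hs, hsO⟩ hz⟩)
      (by
        obtain ⟨z, hz⟩ := hne t
        exact ⟨z, hmem ht hz, hmem (S := (L.stitches : Set Stitch) \ O) ⟨ht, htO⟩ hz⟩)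
    obtain ⟨r, ⟨hr, hrO⟩, hzr⟩ := Set.mem_iUnion₂.1 hzA
    obtain ⟨r', ⟨hr', hrO'⟩, hzr'⟩ := Set.mem_iUnion₂.1 hzB
    obtain ⟨v, h1, h2, -⟩ := (L.inPattern r hr).exists_incident (L.inPattern r' hr')
      (by rintro rfl; exact hrO' hrO) hzr hzr'
    exact hrO' (hO r hr r' hr' hrO v h1 h2)

/-- The column of cells crossed by the horizontal step leaving `p`, when the steps along the
horizontal line `j` are by `-τ j`. -/
def stepColumn (τ : ℤ → ℤ) (p : ℤ × ℤ) : ℤ := min p.1 (p.1 - τ p.2)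

/-- One horizontal step followed by one vertical step, where `τ` and `σ` prescribe the direction
of travel along each horizontal and each vertical line. -/
def doubleStep (σ τ : ℤ → ℤ) (p : ℤ × ℤ) : ℤ × ℤ :=
  (p.1 - τ p.2, p.2 + σ (p.1 - τ p.2))

/-- For walks `X`, `Y` with increments `σ`, `τ`, the trajectory `p` is a contour line of the
height function `X x + Y y` on cells. If `x y` is on it, `c` and `r` are the column and the row of
the cell on its high side. -/
structure ArcInvariant (τ X Y : ℤ → ℤ) (a J x y c r : ℤ) : Prop where
  cell : τ y = -1 ∧ r = y - 1 ∧ c = x ∨ τ y = 1 ∧ r = y ∧ c = x - 1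
  le_column : a ≤ c
  column_le : ∀ i, a ≤ i → i ≤ c → X i ≤ X a
  height : X c + Y r = X a + Y (J - 1)
  row_le : r ≤ J - 1
  le_row : ∀ k, r ≤ k → k ≤ J - 1 → Y (J - 1) ≤ Y k

theorem ArcInvariant.step {σ τ X Y : ℤ → ℤ} (hσ : ∀ i, σ i = 1 ∨ σ i = -1)
    (hτ : ∀ j, τ j = 1 ∨ τ j = -1) (hX : ∀ i, X i = X (i - 1) + σ i)
    (hY : ∀ j, Y j = Y (j - 1) + τ j) {a J x y c r x' y' : ℤ} (hJ : τ J = -1)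
    (h : ArcInvariant τ X Y a J x y c r) (hx' : x' = x - τ y) (hy' : y' = y + σ x')
    (hle : y' ≤ J) (hne : ¬ (c = a ∧ τ y = 1)) :
    ∃ c' r', ArcInvariant τ X Y a J x' y' c' r' ∧ (a < c' ∨ c' = a ∧ τ y' = 1) := by
  obtain ⟨h1, h2, h3, h4, h5, h6⟩ := h
  have hM := hY J
  have hy1 := hY y
  have hy2 := hY (y + 1)
  have hy3 := hY (y - 1)
  simp only [add_sub_cancel_right] at hy2
  rcases h1 with ⟨ht, rfl, rfl⟩ | ⟨ht, rfl, rfl⟩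
  · have hx1 := hX (c + 1)
    simp only [add_sub_cancel_right] at hx1
    obtain rfl : x' = c + 1 := by omega
    have hca := h3 c h2 le_rfl
    rcases hσ (c + 1) with hs | hs
    · obtain rfl : y' = y + 1 := by omega
      have hyJ : y ≤ J - 1 := by omega
      have hy := h6 y (by omega) hyJ
      rcases hτ (y + 1) with ht' | ht'
      · have : y + 1 ≠ J := by rintro rfl; omega
        refine ⟨c, y + 1, ⟨by omega, h2, h3, by omega, by omega,
          fun k hk => h6 k (by omega)⟩, by omega⟩
      · refine ⟨c + 1, y, ⟨by omega, by omega, fun i hi hi' => ?_, by omega, by omega,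
          fun k hk => h6 k (by omega)⟩, by omega⟩
        rcases eq_or_ne i (c + 1) with rfl | hi2
        · omega
        · exact h3 i hi (by omega)
    · obtain rfl : y' = y - 1 := by omega
      rcases hτ (y - 1) with ht' | ht'
      · exact ⟨c, y - 1, ⟨by omega, h2, h3, by omega, by omega, h6⟩, by omega⟩
      · refine ⟨c + 1, y - 1 - 1, ⟨by omega, by omega, fun i hi hi' => ?_, by omega, by omega,
          fun k hk hk' => ?_⟩, by omega⟩
        · rcases eq_or_ne i (c + 1) with rfl | hi2
          · omega
          · exact h3 i hi (by omega)
        · rcases eq_or_ne k (y - 1 - 1) with rfl | hk2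
          · omega
          · exact h6 k (by omega) hk'
  · have hx1 := hX (x - 1)
    obtain rfl : x' = x - 1 := by omega
    have hca := h3 (x - 1) h2 le_rfl
    have hac : a < x - 1 := by omega
    have hca' := h3 (x - 1 - 1) (by omega) (by omega)
    rcases hσ (x - 1) with hs | hs
    · obtain rfl : y' = r + 1 := by omega
      rcases hτ (r + 1) with ht' | ht'
      · have : r + 1 ≠ J := by rintro rfl; omega
        exact ⟨x - 1 - 1, r + 1, ⟨by omega, by omega, fun i hi hi' => h3 i hi (by omega), by omega,
          by omega, fun k hk => h6 k (by omega)⟩, by omega⟩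
      · exact ⟨x - 1, r, ⟨by omega, h2, h3, by omega, by omega, h6⟩, by omega⟩
    · obtain rfl : y' = r - 1 := by omega
      have key : ∀ k, r - 1 ≤ k → k ≤ J - 1 → Y (J - 1) ≤ Y k := by
        intro k hk hk'
        rcases eq_or_ne k (r - 1) with rfl | hk2
        · omega
        · exact h6 k (by omega) hk'
      rcases hτ (r - 1) with ht' | ht'
      · exact ⟨x - 1 - 1, r - 1, ⟨by omega, by omega, fun i hi hi' => h3 i hi (by omega), by omega,
          by omega, key⟩, by omega⟩
      · refine ⟨x - 1, r - 1 - 1, ⟨by omega, h2, h3, by omega, by omega, fun k hk hk' => ?_⟩,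
          by omega⟩
        rcases eq_or_ne k (r - 1 - 1) with rfl | hk2
        · omega
        · exact key k (by omega) hk'

/-- The trajectory that leaves column `a` to the right along its highest line `J` returns to
column `a` for the first time along the line `b`, where `b` depends only on `Y`. -/
theorem exists_first_return {σ τ X Y : ℤ → ℤ} (hσ : ∀ i, σ i = 1 ∨ σ i = -1)
    (hτ : ∀ j, τ j = 1 ∨ τ j = -1) (hX : ∀ i, X i = X (i - 1) + σ i)
    (hY : ∀ j, Y j = Y (j - 1) + τ j) {a J : ℤ} (hJ : τ J = -1) {p : ℕ → ℤ × ℤ}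
    (hp : ∀ m, p (m + 1) = doubleStep σ τ (p m)) (h0 : p 0 = (a, J)) (hle : ∀ m, (p m).2 ≤ J)
    (hper : ∃ n, 0 < n ∧ p n = p 0) :
    ∃ k b, 0 < k ∧ p k = (a + 1, b) ∧ τ b = 1 ∧ b < J ∧ Y b = Y (J - 1) ∧
      (∀ j, b ≤ j → j ≤ J - 1 → Y (J - 1) ≤ Y j) ∧
      ∀ m, 0 < m → m < k → a < stepColumn τ (p m) := by
  classical
  have key : ∀ k, (∀ m, 0 < m → m < k → ¬ (p m = (a + 1, (p m).2) ∧ τ (p m).2 = 1)) →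
      ∃ c r, ArcInvariant τ X Y a J (p k).1 (p k).2 c r ∧
        (0 < k → a < c ∨ c = a ∧ τ (p k).2 = 1) := by
    intro k
    induction k with
    | zero =>
      intro _
      refine ⟨a, J - 1, ?_, by simp⟩
      rw [h0]
      refine ⟨Or.inl ⟨hJ, rfl, rfl⟩, le_rfl, fun i hi hi' => ?_, rfl, le_rfl, fun k hk hk' => ?_⟩
      · rw [le_antisymm hi' hi]
      · rw [le_antisymm hk' hk]
    | succ k ih =>
      intro hk
      obtain ⟨c, r, hI, -⟩ := ih fun m h1 h2 => hk m h1 (by omega)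
      have hstep := hp k
      have hne : ¬ (c = a ∧ τ (p k).2 = 1) := by
        rintro ⟨rfl, ht⟩
        rcases Nat.eq_zero_or_pos k with rfl | hpos
        · rw [h0] at ht
          simp only at ht
          omega
        · refine hk k hpos (by omega) ⟨Prod.ext ?_ rfl, ht⟩
          have := hI.cell
          simp only
          omega
      obtain ⟨c', r', h1, h2⟩ := hI.step hσ hτ hX hY hJ (x' := (p (k + 1)).1)
        (y' := (p (k + 1)).2) (by rw [hstep]; rfl) (by rw [hstep]; rfl) (hle _) hne
      exact ⟨c', r', h1, fun _ => h2⟩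
  have hex : ∃ k, 0 < k ∧ p k = (a + 1, (p k).2) ∧ τ (p k).2 = 1 := by
    by_contra hcon
    push Not at hcon
    obtain ⟨n, hn, hpn⟩ := hper
    obtain ⟨c, r, hI, hc⟩ := key n fun m hm _ h => hcon m hm h.1 h.2
    have h1 := hI.cell
    have h2 := hc hn
    rw [hpn, h0] at h1 h2
    simp only at h1 h2
    omega
  obtain ⟨hk, hpk, hτk⟩ := Nat.find_spec hex
  set k := Nat.find hex
  have hmin : ∀ m, 0 < m → m < k → ¬ (p m = (a + 1, (p m).2) ∧ τ (p m).2 = 1) :=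
    fun m hm hmk h => Nat.find_min hex hmk ⟨hm, h⟩
  obtain ⟨c, r, hI, -⟩ := key k hmin
  have hcell := hI.cell
  have hx : (p k).1 = a + 1 := by rw [hpk]
  obtain rfl : r = (p k).2 := by omega
  obtain rfl : a = c := by omega
  refine ⟨k, (p k).2, hk, hpk, hτk, by have := hI.row_le; omega, by have := hI.height; omega,
    hI.le_row, fun m hm hmk => ?_⟩
  obtain ⟨c', r', hI', hc'⟩ := key m fun m' h1 h2 => hmin m' h1 (by omega)
  have h1 := hI'.cell
  have h2 := hc' hm
  have h3 := hmin m hm hmk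
  have h4 : a < c' := by
    rcases h2 with h2 | ⟨rfl, h2⟩
    · exact h2
    · exact absurd ⟨Prod.ext (by simp only; omega) rfl, h2⟩ h3
  unfold stepColumn
  omega

/-- A periodic trajectory meets column `a` only twice if its highest line is crossed there. -/
theorem eq_of_stepColumn_eq {σ τ X Y : ℤ → ℤ} (hσ : ∀ i, σ i = 1 ∨ σ i = -1)
    (hτ : ∀ j, τ j = 1 ∨ τ j = -1) (hX : ∀ i, X i = X (i - 1) + σ i)
    (hY : ∀ j, Y j = Y (j - 1) + τ j) {a J : ℤ} (hJ : τ J = -1) {p : ℤ → ℤ × ℤ}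
    (hp : ∀ m, p (m + 1) = doubleStep σ τ (p m)) (h0 : p 0 = (a, J)) (hle : ∀ m, (p m).2 ≤ J)
    {n : ℤ} (hn : 0 < n) (hper : ∀ m, p (m + n) = p m) :
    ∃ b, b < J ∧ τ b = 1 ∧ (∃ m, p m = (a + 1, b)) ∧
      ∀ m, stepColumn τ (p m) = a → p m = (a, J) ∨ p m = (a + 1, b) := by
  obtain ⟨k, b, hk, hpk, hτb, hbJ, hYb, hb, hright⟩ :=
    exists_first_return hσ hτ hX hY hJ (p := fun m : ℕ => p m)
      (fun m => by simpa using hp m) (by simpa using h0) (fun m => hle m)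
      ⟨n.toNat, by omega, by simpa [hn.le] using hper 0⟩
  obtain ⟨l, b', hl, hpl, hτb', hbJ', hYb', hb', hleft⟩ :=
    exists_first_return (σ := fun i => -σ (-i)) (X := fun i => X (-i - 1)) (τ := τ) (Y := Y)
      (a := -a - 1) (J := J) (fun i => by have := hσ (-i); omega) hτ
      (fun i => by
        have := hX (-i)
        rw [show -(i - 1) - 1 = -i by ring]
        omega) hY hJ
      (p := fun m : ℕ => (-((p (-m)).1 - τ (p (-m)).2), (p (-m)).2))
      (fun m => by
        have h := hp (-(m + 1 : ℤ))
        rw [show -(m + 1 : ℤ) + 1 = -m by ring] at h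
        simp only [doubleStep] at h ⊢
        push_cast
        rw [h]
        ext <;> simp)
      (by simp [h0, hJ]; ring) (fun m => hle _)
      ⟨n.toNat, by omega, by
        have h := hper (-n)
        rw [neg_add_cancel] at h
        simp [hn.le, h]⟩
  have hbb : b = b' := by
    have e1 := hY b
    have e2 := hY b'
    by_contra hne
    rcases lt_or_gt_of_ne hne with h | h
    · have := hb (b' - 1) (by omega) (by omega)
      omega
    · have := hb' (b - 1) (by omega) (by omega)
      omega
  subst hbb
  have hpl' : p (-l) = (a + 1, b) := by
    simp only [Prod.mk.injEq] at hpl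
    obtain ⟨h1, h2⟩ := hpl
    rw [h2] at h1
    exact Prod.ext (by simp only; omega) h2
  refine ⟨b, hbJ, hτb, ⟨_, hpk⟩, ?_⟩
  have hinj : ∀ m m' : ℤ, p m = p m' → ∀ i : ℕ, p (m + i) = p (m' + i) := by
    intro m m' h i
    induction i with
    | zero => simpa using h
    | succ i ih =>
      push_cast
      rw [← add_assoc, ← add_assoc, hp, hp, ih]
  have hper' : ∀ m : ℤ, p (m + (k + l)) = p m := by
    have hpos : ∀ i : ℕ, p (k + i) = p (-l + i) := hinj _ _ (hpk.trans hpl'.symm)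
    have hlarge : ∀ (j : ℕ) (m : ℤ), p (m + j * n) = p m := by
      intro j m
      induction j with
      | zero => simp
      | succ j ih =>
        push_cast
        rw [add_mul, ← add_assoc, one_mul, hper, ih]
    intro m
    have hge : 0 ≤ m + l + (m + l).natAbs * n := by
      have : |m + l| ≤ (m + l).natAbs * n := by
        rw [Int.natCast_natAbs]
        exact le_mul_of_one_le_right (abs_nonneg _) hn
      have := neg_abs_le (m + l)
      omega
    obtain ⟨i, hi⟩ := Int.eq_ofNat_of_zero_le hge
    have h1 := hpos i
    rw [← hi] at h1
    have e1 : (k : ℤ) + (m + l + (m + l).natAbs * n) = m + (k + l) + (m + l).natAbs * n := by ring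
    have e2 : -(l : ℤ) + (m + l + (m + l).natAbs * n) = m + (m + l).natAbs * n := by ring
    rwa [e1, e2, hlarge, hlarge] at h1
  have hperiodic : Function.Periodic p ((k : ℤ) + l) := hper'
  intro m hm
  have hkl : (0 : ℤ) < k + l := by omega
  have hmod : p m = p (m % (k + l)) := by
    conv_lhs => rw [← Int.emod_add_mul_ediv m (k + l), mul_comm]
    exact hperiodic.int_mul _ _
  have hm0 := Int.emod_nonneg m hkl.ne'
  have hm1 := Int.emod_lt_of_pos m hkl
  rw [hmod] at hm ⊢
  generalize m % ((k : ℤ) + l) = m' at hm hm0 hm1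
  rcases lt_trichotomy m' k with h | h | h
  · rcases eq_or_lt_of_le hm0 with rfl | hpos
    · exact Or.inl h0
    · have := hright m'.toNat (by omega) (by omega)
      simp only [Int.toNat_of_nonneg hm0] at this
      omega
  · subst h
    exact Or.inr hpk
  · have := hleft (k + l - m').toNat (by omega) (by omega)
    rw [Int.toNat_of_nonneg (by omega)] at this
    have e : p (-((k : ℤ) + l - m')) = p m' := by
      rw [← hper' (-((k : ℤ) + l - m'))]
      congr 1
      ring
    simp only [e] at this
    unfold stepColumn at this hm
    simp only at this
    have := hτ (p m').2
    omega

theorem exists_walk (σ : ℤ → ℤ) : ∃ X : ℤ → ℤ, ∀ i, X i = X (i - 1) + σ i := by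
  refine ⟨fun n => ∑ k ∈ Finset.Ioc 0 n, σ k - ∑ k ∈ Finset.Ioc n 0, σ k, fun i => ?_⟩
  simp only
  rcases lt_or_ge 0 i with h | h
  · have e : Finset.Ioc 0 i = insert i (Finset.Ioc 0 (i - 1)) := by
      ext
      simp only [Finset.mem_Ioc, Finset.mem_insert]
      omega
    rw [Finset.Ioc_eq_empty_of_le h.le, Finset.Ioc_eq_empty_of_le (a := i - 1) (by omega), e,
      Finset.sum_insert (by simp)]
    simp [add_comm]
  · have e : Finset.Ioc (i - 1) 0 = insert i (Finset.Ioc i 0) := by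
      ext
      simp only [Finset.mem_Ioc, Finset.mem_insert]
      omega
    rw [Finset.Ioc_eq_empty_of_le h, Finset.Ioc_eq_empty_of_le (b := i - 1) (by omega), e,
      Finset.sum_insert (by simp)]
    simp

theorem exists_direction (ε : ℤ → ZMod 2) (c : ZMod 2) : ∃ σ : ℤ → ℤ,
    (∀ i, σ i = 1 ∨ σ i = -1) ∧ (∀ i, σ i = 1 → ε i = i + c) ∧
      ∀ i, σ i = -1 → ε i = i + c + 1 := by
  classical
  have h2 : ∀ z w : ZMod 2, z ≠ w → z = w + 1 := by decide
  refine ⟨fun i => if ε i = i + c then 1 else -1, fun i => ?_, fun i hi => ?_, fun i hi => ?_⟩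
  · simp only
    split_ifs <;> simp
  · simp only at hi
    split_ifs at hi with h
    exact h
  · simp only at hi
    split_ifs at hi with h
    exact h2 _ _ h

namespace IsGridLoop

variable {ε η : ℤ → ZMod 2} {S : Set Stitch}

theorem vert_inj (h : IsGridLoop ε η S) {i j j' : ℤ} (h1 : Stitch.vert i j ∈ S)
    (h2 : Stitch.vert i j' ∈ S) (h3 : j ≤ j' + 1) (h4 : j' ≤ j + 1) : j = j' :=
  ZMod.intCast_two_inj_of_abs_sub_le
    (Eq.trans (h.inPattern _ h1) (Eq.symm (h.inPattern _ h2))) h3 h4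

theorem horiz_inj (h : IsGridLoop ε η S) {i i' j : ℤ} (h1 : Stitch.horiz i j ∈ S)
    (h2 : Stitch.horiz i' j ∈ S) (h3 : i ≤ i' + 1) (h4 : i' ≤ i + 1) : i = i' :=
  ZMod.intCast_two_inj_of_abs_sub_le
    (Eq.trans (h.inPattern _ h1) (Eq.symm (h.inPattern _ h2))) h3 h4

theorem vert_mem_of_horiz (h : IsGridLoop ε η S) {i j x : ℤ} (hs : Stitch.horiz i j ∈ S)
    (hx : x = i ∨ x = i + 1) : Stitch.vert x j ∈ S ∨ Stitch.vert x (j - 1) ∈ S := by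
  obtain ⟨t, ht, hne, hinc⟩ := h.exists_ne _ hs (x, j) (by simpa [Stitch.Incident] using hx)
  cases t with
  | vert i' j' =>
    simp only [Stitch.Incident, Prod.mk.injEq] at hinc
    rcases hinc with ⟨rfl, rfl⟩ | ⟨rfl, rfl⟩
    · exact Or.inl ht
    · exact Or.inr (by simpa using ht)
  | horiz i' j' =>
    simp only [Stitch.Incident, Prod.mk.injEq] at hinc
    obtain rfl : j = j' := by omega
    exact absurd (congrArg (Stitch.horiz · j)
      (h.horiz_inj ht hs (by omega) (by omega))) hne

theorem horiz_mem_of_vert (h : IsGridLoop ε η S) {i j y : ℤ} (hs : Stitch.vert i j ∈ S)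
    (hy : y = j ∨ y = j + 1) : Stitch.horiz i y ∈ S ∨ Stitch.horiz (i - 1) y ∈ S := by
  obtain ⟨t, ht, hne, hinc⟩ := h.exists_ne _ hs (i, y) (by simpa [Stitch.Incident] using hy)
  cases t with
  | horiz i' j' =>
    simp only [Stitch.Incident, Prod.mk.injEq] at hinc
    rcases hinc with ⟨rfl, rfl⟩ | ⟨rfl, rfl⟩
    · exact Or.inl ht
    · exact Or.inr (by simpa using ht)
  | vert i' j' =>
    simp only [Stitch.Incident, Prod.mk.injEq] at hinc
    obtain rfl : i = i' := by omega
    exact absurd (congrArg (Stitch.vert i) (h.vert_inj ht hs (by omega) (by omega))) hne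

theorem preimage (h : IsGridLoop ε η S) {e : Stitch → Stitch} {g : ℤ × ℤ → ℤ × ℤ}
    (he : Function.Involutive e) (hinc : ∀ s v, s.Incident v → (e s).Incident (g v))
    (hg : Function.Involutive g) {ε' η' : ℤ → ZMod 2}
    (hpat : ∀ s, (e s).InPattern ε η → s.InPattern ε' η') : IsGridLoop ε' η' (e ⁻¹' S) where
  finite := h.finite.preimage he.injective.injOn
  inPattern s hs := hpat s (h.inPattern _ hs)
  exists_ne s hs v hv := by
    obtain ⟨t, ht, hne, ht'⟩ := h.exists_ne _ hs _ (hinc _ _ hv)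
    refine ⟨e t, by rwa [Set.mem_preimage, he], fun h => hne ?_, ?_⟩
    · rw [← h, he]
    · simpa only [hg v] using hinc _ _ ht'
  connected O := by
    rintro ⟨s, hs, hsO⟩ hO t ht
    have := h.connected (e ⁻¹' O) ⟨e s, hs, by rwa [Set.mem_preimage, he]⟩
      (fun s hs t ht hsO v hsv htv => hO (e s) (by rwa [Set.mem_preimage, he]) (e t)
        (by rwa [Set.mem_preimage, he]) hsO (g v) (hinc _ _ hsv) (hinc _ _ htv)) ht
    rwa [Set.mem_preimage, he] at this

theorem exists_horiz_pair_of_north (h : IsGridLoop ε η S) {a J : ℤ}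
    (ha : Stitch.horiz a J ∈ S) (hmax : ∀ i j, Stitch.horiz i j ∈ S → j ≤ J) :
    ∃ b, b < J ∧ Stitch.horiz a b ∈ S ∧ ∀ j, Stitch.horiz a j ∈ S → j = J ∨ j = b := by
  have two : (1 : ZMod 2) + 1 = 0 := by decide
  obtain ⟨σ, hσ, hσ1, hσ2⟩ := exists_direction ε (a - J + 1)
  obtain ⟨τ, hτ, hτ1, hτ2⟩ := exists_direction η (a - J + 1)
  obtain ⟨X, hX⟩ := exists_walk σ
  obtain ⟨Y, hY⟩ := exists_walk τ
  have hJ : τ J = -1 := by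
    refine (hτ J).resolve_left fun h1 => ?_
    have e1 := hτ1 J h1
    have e2 : (a : ZMod 2) = η J := h.inPattern _ ha
    rw [← e2] at e1
    have : (1 : ZMod 2) = 0 := by linear_combination -e1
    exact one_ne_zero this
  set Good : ℤ × ℤ → Prop := fun p =>
    (p.1 : ZMod 2) = p.2 + (a - J) ∧ Stitch.horiz (stepColumn τ p) p.2 ∈ S
  have hcol : ∀ p, (τ p.2 = 1 ∧ stepColumn τ p = p.1 - 1) ∨ (τ p.2 = -1 ∧ stepColumn τ p = p.1) :=
    fun p => by
      have := hτ p.2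
      unfold stepColumn
      omega
  have hstep : ∀ p, Good p → Good (doubleStep σ τ p) ∧
      Stitch.vert (doubleStep σ τ p).1 (min p.2 (doubleStep σ τ p).2) ∈ S := by
    rintro ⟨x, y⟩ ⟨hpar, hp⟩
    have hc := hcol (x, y)
    simp only at hpar hp hc
    have hv := h.vert_mem_of_horiz hp (x := x - τ y) (by omega)
    obtain ⟨x', hx'⟩ : ∃ x', x' = x - τ y := ⟨_, rfl⟩
    have hpar' : (x' : ZMod 2) = y + (a - J) + 1 := by
      rcases hτ y with ht | ht <;> rw [hx', ht] <;> push_cast <;> rw [hpar]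
      · linear_combination -two
      · ring
    have hvS : Stitch.vert x' (min y (y + σ x')) ∈ S := by
      rw [← hx'] at hv
      rcases hσ x' with hs | hs
      · rw [hs, min_eq_left (by omega)]
        refine hv.resolve_right fun hv' => ?_
        have e1 : ((y - 1 : ℤ) : ZMod 2) = ε x' := h.inPattern _ hv'
        rw [hσ1 x' hs, hpar'] at e1
        push_cast at e1
        exact one_ne_zero (α := ZMod 2) (by linear_combination -e1 - (a - J + 1) * two)
      · rw [hs, min_eq_right (by omega)]
        refine hv.resolve_left fun hv' => ?_
        have e1 : (y : ZMod 2) = ε x' := h.inPattern _ hv'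
        rw [hσ2 x' hs, hpar'] at e1
        exact one_ne_zero (α := ZMod 2) (by linear_combination -e1 - (a - J + 1) * two)
    have hh := h.horiz_mem_of_vert hvS (y := y + σ x') (by have := hσ x'; omega)
    have hpar'' : (x' : ZMod 2) = ((y + σ x' : ℤ) : ZMod 2) + (a - J) := by
      rcases hσ x' with hs | hs <;> rw [hs, hpar'] <;> push_cast
      · ring
      · linear_combination two
    have e : doubleStep σ τ (x, y) = (x', y + σ x') := by rw [hx']; rfl
    rw [e]
    refine ⟨⟨hpar'', ?_⟩, hvS⟩
    have hc' := hcol (x', y + σ x')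
    simp only at hc' ⊢
    rcases hc' with ⟨ht, hc'⟩ | ⟨ht, hc'⟩
    · rw [hc']
      refine hh.resolve_left fun hh' => ?_
      have e1 : (x' : ZMod 2) = η (y + σ x') := h.inPattern _ hh'
      rw [hτ1 _ ht, hpar''] at e1
      exact one_ne_zero (α := ZMod 2) (by linear_combination -e1)
    · rw [hc']
      refine hh.resolve_right fun hh' => ?_
      have e1 : ((x' - 1 : ℤ) : ZMod 2) = η (y + σ x') := h.inPattern _ hh'
      rw [hτ2 _ ht] at e1
      push_cast at e1
      rw [hpar''] at e1
      push_cast at e1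
      exact one_ne_zero (α := ZMod 2) (by linear_combination -e1 - two)
  have hinj : Function.Injective (doubleStep σ τ) := by
    rintro ⟨x, y⟩ ⟨x', y'⟩ h
    simp only [doubleStep, Prod.mk.injEq] at h
    obtain ⟨h1, h2⟩ := h
    rw [h1] at h2
    obtain rfl : y = y' := by omega
    exact Prod.ext (by simp only; omega) rfl
  have hgood0 : Good (a, J) := by
    have := hcol (a, J)
    simp only at this
    refine ⟨by simp, ?_⟩
    rwa [(this.resolve_left (by omega)).2]
  have hgood : ∀ m, Good ((doubleStep σ τ)^[m] (a, J)) := by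
    intro m
    induction m with
    | zero => exact hgood0
    | succ m ih =>
      rw [Function.iterate_succ_apply']
      exact (hstep _ ih).1
  have hfin : {p | Good p}.Finite := by
    refine h.finite.of_injOn (f := fun p => Stitch.horiz (stepColumn τ p) p.2)
      (fun p hp => hp.2) fun p hp p' hp' heq => ?_
    simp only [Stitch.horiz.injEq] at heq
    have h1 := hcol p
    have h2 := hcol p'
    rw [heq.2] at h1
    exact Prod.ext (by omega) heq.2
  obtain ⟨n, hn, hper⟩ : ∃ n, 0 < n ∧ (doubleStep σ τ)^[n] (a, J) = (a, J) := by
    obtain ⟨k, l, hkl, he⟩ := hfin.exists_lt_map_eq_of_forall_mem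
      (f := fun m : ℕ => (doubleStep σ τ)^[m] (a, J)) hgood
    refine ⟨l - k, by omega, hinj.iterate k ?_⟩
    rw [← Function.iterate_add_apply, show k + (l - k) = l by omega]
    exact he.symm
  set p : ℤ → ℤ × ℤ := fun m => (doubleStep σ τ)^[(m % n).toNat] (a, J)
  have hgoodp : ∀ m, Good (p m) := fun m => hgood _
  have hp : ∀ m, p (m + 1) = doubleStep σ τ (p m) := by
    intro m
    have h1 := Int.emod_nonneg m (show (n : ℤ) ≠ 0 by omega)
    have h2 := Int.emod_lt_of_pos m (show (0 : ℤ) < n by omega)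
    simp only [p]
    rw [← Function.iterate_succ_apply' (doubleStep σ τ), ← Int.emod_add_emod]
    rcases (show m % n + 1 ≤ n from h2).eq_or_lt with h3 | h3
    · rw [h3, Int.emod_self, show (m % n).toNat.succ = n by omega, hper]
      rfl
    · rw [Int.emod_eq_of_lt (by omega) h3]
      congr 1
      omega
  obtain ⟨b, hbJ, hτb, ⟨k, hk⟩, hb⟩ := eq_of_stepColumn_eq hσ hτ hX hY hJ hp (a := a)
    (by simp [p]) (fun m => hmax _ _ (hgoodp m).2) (show (0 : ℤ) < n by omega)
    (fun m => by simp [p])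
  refine ⟨b, hbJ, ?_, ?_⟩
  · have h1 := (hgoodp k).2
    have h2 := hcol (p k)
    rw [hk] at h1 h2
    simp only at h1 h2
    rwa [show stepColumn τ (a + 1, b) = a by omega] at h1
  · have hall : ∀ i j, Stitch.horiz i j ∈ S → ∃ m, stepColumn τ (p m) = i ∧ (p m).2 = j := by
      have hv : ∀ m, Stitch.vert (p (m + 1)).1 (min (p m).2 (p (m + 1)).2) ∈ S := fun m => by
        rw [hp]
        exact (hstep _ (hgoodp m)).2
      have hends : ∀ m, (stepColumn τ (p m) = (p m).1 ∧ (p (m + 1)).1 = (p m).1 + 1 ∨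
          stepColumn τ (p m) = (p m).1 - 1 ∧ (p (m + 1)).1 = (p m).1 - 1) ∧
          ((p (m + 1)).2 = (p m).2 + 1 ∨ (p (m + 1)).2 = (p m).2 - 1) := fun m => by
        have h1 := hcol (p m)
        have h2 := hσ ((p m).1 - τ (p m).2)
        rw [hp]
        simp only [doubleStep]
        omega
      have hsub := h.connected {s | Stitch.rec (motive := fun _ => Prop)
          (fun i j => ∃ m, (p (m + 1)).1 = i ∧ min (p m).2 (p (m + 1)).2 = j)
          (fun i j => ∃ m, stepColumn τ (p m) = i ∧ (p m).2 = j) s}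
        ⟨_, (hgoodp 0).2, 0, rfl, rfl⟩ ?_
      · exact fun i j hij => hsub hij
      rintro (⟨i, j⟩ | ⟨i, j⟩) hs (⟨i', j'⟩ | ⟨i', j'⟩) ht ⟨m, rfl, rfl⟩ ⟨x, y⟩ hsv htv <;>
        simp only [Stitch.Incident, Prod.mk.injEq] at hsv htv
      · obtain rfl : i' = (p (m + 1)).1 := by omega
        exact ⟨m, rfl, h.vert_inj hs ht (by omega) (by omega)⟩
      · have h1 := hends m
        have h2 := hends (m + 1)
        by_cases hy : y = (p m).2
        · have : j' = (p m).2 := by omega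
          subst this
          exact ⟨m, h.horiz_inj (hgoodp m).2 ht (by omega) (by omega), rfl⟩
        · have : j' = (p (m + 1)).2 := by omega
          subst this
          exact ⟨m + 1, h.horiz_inj (hgoodp (m + 1)).2 ht (by omega) (by omega), rfl⟩
      · have h1 := hends m
        have h2 := hends (m - 1)
        have h3 := hv (m - 1)
        rw [sub_add_cancel] at h2 h3
        by_cases hx : x = (p m).1
        · have : i' = (p m).1 := by omega
          subst this
          exact ⟨m - 1, by rw [sub_add_cancel], by
            rw [sub_add_cancel]
            exact h.vert_inj h3 ht (by omega) (by omega)⟩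
        · have : i' = (p (m + 1)).1 := by omega
          subst this
          exact ⟨m, rfl, h.vert_inj (hv m) ht (by omega) (by omega)⟩
      · have : j' = (p m).2 := by omega
        subst this
        exact ⟨m, h.horiz_inj hs ht (by omega) (by omega), rfl⟩
    intro j hj
    obtain ⟨m, hm, rfl⟩ := hall a j hj
    rcases hb m hm with h | h <;> rw [h] <;> simp

theorem exists_horiz_pair (h : IsGridLoop ε η S) {a J : ℤ} (ha : Stitch.horiz a J ∈ S)
    (hext : (∀ i j, Stitch.horiz i j ∈ S → j ≤ J) ∨ ∀ i j, Stitch.horiz i j ∈ S → J ≤ j) :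
    ∃ j1 j2, j1 ≠ j2 ∧ Stitch.horiz a j1 ∈ S ∧ Stitch.horiz a j2 ∈ S ∧
      ∀ j, Stitch.horiz a j ∈ S → j = j1 ∨ j = j2 := by
  rcases hext with hmax | hmin
  · obtain ⟨b, hb, hbS, hall⟩ := h.exists_horiz_pair_of_north ha hmax
    exact ⟨J, b, hb.ne', ha, hbS, hall⟩
  · set e : Stitch → Stitch := fun s => Stitch.rec (fun i j => .vert i (-j - 1))
      (fun i j => .horiz i (-j)) s with he
    have hflip : IsGridLoop (fun i => ε i + 1) (fun j => η (-j)) (e ⁻¹' S) := by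
      refine h.preimage (g := fun v => (v.1, -v.2)) ?_ ?_ ?_ ?_
      · rintro (⟨i, j⟩ | ⟨i, j⟩) <;> simp [he]
      · rintro (⟨i, j⟩ | ⟨i, j⟩) ⟨x, y⟩ hv <;>
          simp only [Stitch.Incident, Prod.mk.injEq, he] at hv ⊢ <;> omega
      · rintro ⟨x, y⟩
        simp
      · rintro (⟨i, j⟩ | ⟨i, j⟩) hs
        · have hs' : ((-j - 1 : ℤ) : ZMod 2) = ε i := hs
          change (j : ZMod 2) = ε i + 1
          rw [← hs']
          push_cast
          rw [sub_add_cancel, ZMod.neg_eq_self_mod_two]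
        · exact hs
    obtain ⟨b, hb, hbS, hall⟩ := hflip.exists_horiz_pair_of_north (a := a) (J := -J)
      (show Stitch.horiz a (- -J) ∈ S by rwa [neg_neg]) fun i j hij => by
        have := hmin i (-j) hij
        omega
    refine ⟨J, -b, by omega, ha, hbS, fun j hj => ?_⟩
    have := hall (-j) (show Stitch.horiz a (- -j) ∈ S by rwa [neg_neg])
    omega

theorem exists_vert_pair (h : IsGridLoop ε η S) {b I : ℤ} (hb : Stitch.vert I b ∈ S)
    (hext : (∀ i j, Stitch.vert i j ∈ S → i ≤ I) ∨ ∀ i j, Stitch.vert i j ∈ S → I ≤ i) :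
    ∃ i1 i2, i1 ≠ i2 ∧ Stitch.vert i1 b ∈ S ∧ Stitch.vert i2 b ∈ S ∧
      ∀ i, Stitch.vert i b ∈ S → i = i1 ∨ i = i2 := by
  set e : Stitch → Stitch := fun s => Stitch.rec (fun i j => .horiz j i)
    (fun i j => .vert j i) s with he
  have hswap : IsGridLoop η ε (e ⁻¹' S) := by
    refine h.preimage (g := Prod.swap) ?_ ?_ Prod.swap_swap ?_
    · rintro (⟨i, j⟩ | ⟨i, j⟩) <;> rfl
    · rintro (⟨i, j⟩ | ⟨i, j⟩) ⟨x, y⟩ hv <;>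
        simp only [Stitch.Incident, Prod.mk.injEq, Prod.swap_prod_mk, he] at hv ⊢ <;> omega
    · rintro (⟨i, j⟩ | ⟨i, j⟩) hs <;> exact hs
  exact hswap.exists_horiz_pair (a := b) (J := I) hb
    (hext.imp (fun H i j hij => H j i hij) fun H i j hij => H j i hij)

end IsGridLoop

/-- If a hitomezashi loop `L` has a north-extremal or south-extremal
horizontal stitch at longitude `i + 1/2`, then `L` has exactly two stitches at that
longitude; similarly, if `L` has an east-extremal or west-extremal vertical stitch at
latitude `j + 1/2`, then `L` has exactly two stitches at that latitude. (The stitches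
at a half-integer longitude are exactly the horizontal ones, and the stitches at a
half-integer latitude are exactly the vertical ones.) -/
theorem hitomezashi_extremal_two_stitches (ε η : ℤ → ZMod 2) (L : HLoop ε η) :
    (∀ i : ℤ,
      ((∃ j, Stitch.horiz i j ∈ L.stitches ∧
          ∀ i' j' : ℤ, Stitch.horiz i' j' ∈ L.stitches → j' ≤ j) ∨
       (∃ j, Stitch.horiz i j ∈ L.stitches ∧
          ∀ i' j' : ℤ, Stitch.horiz i' j' ∈ L.stitches → j ≤ j')) →
      ∃ j1 j2 : ℤ, j1 ≠ j2 ∧ Stitch.horiz i j1 ∈ L.stitches ∧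
        Stitch.horiz i j2 ∈ L.stitches ∧
        ∀ j : ℤ, Stitch.horiz i j ∈ L.stitches → j = j1 ∨ j = j2) ∧
    (∀ j : ℤ,
      ((∃ i, Stitch.vert i j ∈ L.stitches ∧
          ∀ i' j' : ℤ, Stitch.vert i' j' ∈ L.stitches → i' ≤ i) ∨
       (∃ i, Stitch.vert i j ∈ L.stitches ∧
          ∀ i' j' : ℤ, Stitch.vert i' j' ∈ L.stitches → i ≤ i')) →
      ∃ i1 i2 : ℤ, i1 ≠ i2 ∧ Stitch.vert i1 j ∈ L.stitches ∧
        Stitch.vert i2 j ∈ L.stitches ∧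
        ∀ i : ℤ, Stitch.vert i j ∈ L.stitches → i = i1 ∨ i = i2) := by
  refine ⟨?_, ?_⟩
  · rintro i (⟨j, hj, H⟩ | ⟨j, hj, H⟩)
    · exact L.isGridLoop.exists_horiz_pair hj (Or.inl H)
    · exact L.isGridLoop.exists_horiz_pair hj (Or.inr H)
  · rintro j (⟨i, hi, H⟩ | ⟨i, hi, H⟩)
    · exact L.isGridLoop.exists_vert_pair hi (Or.inl H)
    · exact L.isGridLoop.exists_vert_pair hi (Or.inr H)
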